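/- Let λ = (λ_1,…,λ_m) ∈ W^odd admit a chain of degree d ≤ (1^m) from the identity coset to λ. If max{λ_1,…,λ_m} ≤ 2n+2−m (that is, Λ^m_m ≤ (m+1)̄), then λ ⪯ δ¹, i.e. Λ^k_i ≤ Δ^k_i for all 1 ≤ i ≤ k ≤ m where Δ^k is the increasing rearrangement of the first k entries of δ¹. -/

import Mathlib

/-- Roots of `R⁺ \ R_P⁺`: the formal symbols `t_i - t_j`, `t_i + t_j` and `2 t_i`. -/
inductive OddRoot : Type where
  | tminus (i j : ℕ) : OddRoot
  | tplus (i j : ℕ) : OddRoot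
  | double (i : ℕ) : OddRoot
deriving DecidableEq

namespace OddRoot

/-- The conditions for a formal symbol to be a root of `R⁺ \ R_P⁺`. -/
def valid (n m : ℕ) : OddRoot → Prop
  | tminus i j => 1 ≤ i ∧ i ≤ m ∧ i < j ∧ j ≤ n + 1
  | tplus i j => 1 ≤ i ∧ i ≤ m ∧ i < j ∧ j ≤ n + 1
  | double i => 1 ≤ i ∧ i ≤ m

/-- The reflection associated to a root, as a (signed) permutation of the
ground set `{1,…,2n+2}` inside `ℕ`, where `ī = 2n+3-i`. -/
def refl (n : ℕ) : OddRoot → Equiv.Perm ℕ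
  | tminus i j => Equiv.swap i j * Equiv.swap (2*n+3-i) (2*n+3-j)
  | tplus i j => Equiv.swap i (2*n+3-j) * Equiv.swap j (2*n+3-i)
  | double i => Equiv.swap i (2*n+3-i)

/-- The degree vector of a root: `deg α k` is the coefficient of the `k`-th
simple coroot in `α∨`. -/
def deg : OddRoot → ℕ → ℤ
  | tminus i j, k => if i ≤ k ∧ k < j then 1 else 0
  | tplus i j, k => (if i ≤ k then (1:ℤ) else 0) + (if j ≤ k then 1 else 0)
  | double i, k => if i ≤ k then 1 else 0

end OddRoot

/-- The total degree of a chain of roots. -/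
def chainDeg (L : List OddRoot) (k : ℕ) : ℤ := (L.map (fun α => α.deg k)).sum

/-- `IsChainTo n m L lam` : the sequence of roots `L = [α₁,…,α_t]` is a chain from the
identity coset to the tuple `lam`, i.e. each `αᵢ` is in `R⁺ \ R_P⁺` and the composite
`w = s_{α₁} ∘ ⋯ ∘ s_{α_t}` satisfies `w i = lam i` for `1 ≤ i ≤ m`. -/
def IsChainTo (n m : ℕ) (L : List OddRoot) (lam : ℕ → ℕ) : Prop :=
  (∀ α ∈ L, α.valid n m) ∧
  ∀ i ∈ Finset.Icc 1 m, ((L.map (OddRoot.refl n)).prod) i = lam i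

/-- `W^odd`: tuples `(lam 1, …, lam m)` of pairwise distinct elements of `{1,…,2n+1}`
with no two entries summing to `2n+3`. -/
def Wodd (n m : ℕ) (lam : ℕ → ℕ) : Prop :=
  (∀ i ∈ Finset.Icc 1 m, lam i ∈ Finset.Icc 1 (2*n+1)) ∧
  (∀ i ∈ Finset.Icc 1 m, ∀ j ∈ Finset.Icc 1 m, i ≠ j → lam i ≠ lam j) ∧
  (∀ i ∈ Finset.Icc 1 m, ∀ j ∈ Finset.Icc 1 m, lam i + lam j ≠ 2*n+3)

/-- `LamEntry lam k i = Λᵏᵢ`, the `i`-th smallest element of `{lam 1, …, lam k}`. -/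
def LamEntry (lam : ℕ → ℕ) (k i : ℕ) : ℕ :=
  (((Finset.Icc 1 k).image lam).sort (· ≤ ·)).getD (i-1) 0

/-- The Bruhat-type order `λ ⪯ δ`: `Λᵏᵢ ≤ Δᵏᵢ` for all `1 ≤ i ≤ k ≤ m`. -/
def Dominates (m : ℕ) (lam del : ℕ → ℕ) : Prop :=
  ∀ k ∈ Finset.Icc 1 m, ∀ i ∈ Finset.Icc 1 k, LamEntry lam k i ≤ LamEntry del k i

/-- The tuples `δʲ`: `δ¹ = ((m+1)̄ | 2 | 3 | ⋯ | m)` and, for `2 ≤ j ≤ m`,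
`δʲ = (j̄ | 2 | ⋯ | j-1 | 1 | j+1 | ⋯ | m)`. -/
def delta (n m j : ℕ) : ℕ → ℕ := fun i =>
  if j = 1 then (if i = 1 then 2*n+2-m else i)
  else if i = 1 then 2*n+3-j else if i = j then 1 else i

/-- The pattern vector `(0^a 1^b c^(m-a-b))`. -/
def patvec (a b : ℕ) (c : ℤ) : ℕ → ℤ := fun k =>
  if k ≤ a then 0 else if k ≤ a + b then 1 else c

/-- The simple reflections `s_k` (`1 ≤ k ≤ n`, swapping `k ↔ k+1` and `k̄ ↔ (k+1)̄`)
and `s_{n+1}` (swapping `n+1 ↔ (n+1)̄ = n+2`). -/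
def simpleRefl (n k : ℕ) : Equiv.Perm ℕ :=
  if k ≤ n then Equiv.swap k (k+1) * Equiv.swap (2*n+3-k) (2*n+2-k)
  else Equiv.swap (n+1) (n+2)

theorem aux_single (n m : ℕ) (hmn : m ≤ n) (K : ℕ) (hK : K ≤ m) (α : OddRoot)
    (hv : α.valid n m) :
    (((Finset.Icc 1 K).filter (fun b => α.refl n b ∉ Finset.Icc 1 K)).card : ℤ) ≤ α.deg K := by
  cases α with
  | tminus i j =>
    obtain ⟨h1, h2, h3, h4⟩ := hv
    simp only [OddRoot.deg, OddRoot.refl]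
    split_ifs with h
    · have : ((Finset.Icc 1 K).filter (fun b => (Equiv.swap i j * Equiv.swap (2*n+3-i) (2*n+3-j)) b ∉ Finset.Icc 1 K)) ⊆ {i} := by
        intro b hb
        simp only [Finset.mem_filter, Finset.mem_Icc, Equiv.Perm.mul_apply, Equiv.swap_apply_def, Finset.mem_singleton] at hb ⊢
        grind
      have := Finset.card_le_card this
      simp only [Finset.card_singleton] at this
      exact_mod_cast this
    · have : ((Finset.Icc 1 K).filter (fun b => (Equiv.swap i j * Equiv.swap (2*n+3-i) (2*n+3-j)) b ∉ Finset.Icc 1 K)) ⊆ ∅ := by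
        intro b hb
        simp only [Finset.mem_filter, Finset.mem_Icc, Equiv.Perm.mul_apply, Equiv.swap_apply_def] at hb ⊢
        grind
      have := Finset.card_le_card this
      simp only [Finset.card_empty] at this
      exact_mod_cast this
  | tplus i j =>
    obtain ⟨h1, h2, h3, h4⟩ := hv
    simp only [OddRoot.deg, OddRoot.refl]
    have : ((Finset.Icc 1 K).filter (fun b => (Equiv.swap i (2*n+3-j) * Equiv.swap j (2*n+3-i)) b ∉ Finset.Icc 1 K)) ⊆ (if i ≤ K then {i} else ∅) ∪ (if j ≤ K then {j} else ∅) := by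
      intro b hb
      simp only [Finset.mem_filter, Finset.mem_Icc, Equiv.Perm.mul_apply, Equiv.swap_apply_def, Finset.mem_union] at hb ⊢
      grind
    have h5 := (Finset.card_le_card this).trans (Finset.card_union_le _ _)
    split_ifs at h5 ⊢ <;> simp only [Finset.card_singleton, Finset.card_empty] at h5 <;> exact_mod_cast h5
  | double i =>
    obtain ⟨h1, h2⟩ := hv
    simp only [OddRoot.deg, OddRoot.refl]
    have : ((Finset.Icc 1 K).filter (fun b => (Equiv.swap i (2*n+3-i)) b ∉ Finset.Icc 1 K)) ⊆ (if i ≤ K then {i} else ∅) := by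
      intro b hb
      simp only [Finset.mem_filter, Finset.mem_Icc, Equiv.swap_apply_def] at hb ⊢
      grind
    have h5 := Finset.card_le_card this
    split_ifs at h5 ⊢ <;> simp only [Finset.card_singleton, Finset.card_empty] at h5 <;> exact_mod_cast h5

theorem aux_chain (n m : ℕ) (hmn : m ≤ n) (K : ℕ) (hK : K ≤ m) (L : List OddRoot)
    (hv : ∀ α ∈ L, α.valid n m) :
    (((Finset.Icc 1 K).filter (fun b => (L.map (OddRoot.refl n)).prod b ∉ Finset.Icc 1 K)).card : ℤ)
      ≤ chainDeg L K := by
  induction L with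
  | nil =>
    have : ((Finset.Icc 1 K).filter (fun b => (([] : List OddRoot).map (OddRoot.refl n)).prod b ∉ Finset.Icc 1 K)) = ∅ := by
      ext b; simp
    rw [this]; simp [chainDeg]
  | cons α L ih =>
    have ih := ih (fun β hβ => hv β (List.mem_cons_of_mem _ hβ))
    have h1 := aux_single n m hmn K hK α (hv α List.mem_cons_self)
    have hd : chainDeg (α :: L) K = α.deg K + chainDeg L K := by simp [chainDeg]
    rw [hd]
    set w := (L.map (OddRoot.refl n)).prod with hw
    have hp : ((α :: L).map (OddRoot.refl n)).prod = α.refl n * w := by simp [hw]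
    rw [hp]
    have hsub : ((Finset.Icc 1 K).filter (fun b => (α.refl n * w) b ∉ Finset.Icc 1 K)) ⊆
        ((Finset.Icc 1 K).filter (fun b => α.refl n b ∉ Finset.Icc 1 K)).image w.symm ∪
        (Finset.Icc 1 K).filter (fun b => w b ∉ Finset.Icc 1 K) := by
      intro b hb
      rw [Finset.mem_filter, Equiv.Perm.mul_apply] at hb
      rw [Finset.mem_union, Finset.mem_image, Finset.mem_filter]
      by_cases h : w b ∈ Finset.Icc 1 K
      · left
        exact ⟨w b, Finset.mem_filter.2 ⟨h, hb.2⟩, by simp⟩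
      · exact Or.inr ⟨hb.1, h⟩
    have h2 := (Finset.card_le_card hsub).trans (Finset.card_union_le _ _)
    have h3 := Finset.card_image_le (s := (Finset.Icc 1 K).filter (fun b => α.refl n b ∉ Finset.Icc 1 K)) (f := w.symm)
    have h4 := h2.trans (Nat.add_le_add_right h3 _)
    omega

theorem aux_upper (s : Finset ℕ) (i c : ℕ) (hi : 1 ≤ i)
    (h : i ≤ (s.filter (fun x => x ≤ c)).card) : (s.sort (· ≤ ·)).getD (i-1) 0 ≤ c := by
  by_contra hc
  push Not at hc
  set l := s.sort (· ≤ ·) with hl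
  have hs : l.SortedLE := (Finset.pairwise_sort s (· ≤ ·)).sortedLE
  have hsub : s.filter (fun x => x ≤ c) ⊆ (Finset.range (i-1)).image (fun t => l.getD t 0) := by
    intro x hx
    rw [Finset.mem_filter] at hx
    have hxl : x ∈ l := (Finset.mem_sort _).2 hx.1
    obtain ⟨t, ht, rfl⟩ := List.mem_iff_getElem.1 hxl
    refine Finset.mem_image.2 ⟨t, ?_, List.getD_eq_getElem _ _ ht⟩
    rw [Finset.mem_range]
    by_contra hti
    push Not at hti
    have hlt : i - 1 < l.length := lt_of_le_of_lt hti ht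
    rw [List.getD_eq_getElem _ _ hlt] at hc
    have := hs.getElem_le_getElem_of_le (hi := hlt) (hj := ht) hti
    omega
  have h1 := (Finset.card_le_card hsub).trans Finset.card_image_le
  rw [Finset.card_range] at h1
  omega

theorem aux_lower (s : Finset ℕ) (i c : ℕ) (hi : 1 ≤ i) (hs : i ≤ s.card)
    (h : (s.filter (fun x => x < c)).card < i) : c ≤ (s.sort (· ≤ ·)).getD (i-1) 0 := by
  by_contra hc
  push Not at hc
  set l := s.sort (· ≤ ·) with hl
  have hso : l.SortedLE := (Finset.pairwise_sort s (· ≤ ·)).sortedLE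
  have hnd : l.Nodup := Finset.sort_nodup s _
  have hlen : l.length = s.card := Finset.length_sort _
  rw [List.getD_eq_getElem _ _ (by omega)] at hc
  have hsub : (Finset.range i).image (fun t => l.getD t 0) ⊆ s.filter (fun x => x < c) := by
    intro x hx
    obtain ⟨t, ht, rfl⟩ := Finset.mem_image.1 hx
    rw [Finset.mem_range] at ht
    have htl : t < l.length := by omega
    simp only [List.getD_eq_getElem _ _ htl]
    refine Finset.mem_filter.2 ⟨(Finset.mem_sort (· ≤ ·)).1 (List.getElem_mem htl), ?_⟩
    have := hso.getElem_le_getElem_of_le (hi := htl) (hj := by omega) (show t ≤ i - 1 by omega)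
    omega
  have h1 := Finset.card_le_card hsub
  rw [Finset.card_image_of_injOn, Finset.card_range] at h1
  · omega
  · intro a ha b hb hab
    simp only [Finset.coe_range, Set.mem_Iio] at ha hb
    have ha' : a < l.length := by omega
    have hb' : b < l.length := by omega
    simp only [List.getD_eq_getElem _ _ ha', List.getD_eq_getElem _ _ hb'] at hab
    exact (hnd.getElem_inj_iff).1 hab

theorem aux_delta (n m : ℕ) (hmn : m ≤ n) (k i c : ℕ) (hk : k ≤ m) (hi : 1 ≤ i) (hik : i ≤ k)
    (hc : c ≤ 2*n+2-m) (hci : i < k → c ≤ i+1) : c ≤ LamEntry (delta n m 1) k i := by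
  apply aux_lower _ _ _ hi
  · rw [Finset.card_image_of_injOn, Nat.card_Icc]
    · omega
    · intro a ha b hb hab
      simp only [Finset.coe_Icc, Set.mem_Icc] at ha hb
      simp only [delta, if_true] at hab
      split_ifs at hab <;> omega
  · have hsub : ((Finset.Icc 1 k).image (delta n m 1)).filter (fun x => x < c) ⊆ Finset.Icc 2 i := by
      intro x hx
      rw [Finset.mem_filter] at hx
      obtain ⟨hx, hxc⟩ := hx
      obtain ⟨a, ha, rfl⟩ := Finset.mem_image.1 hx
      rw [Finset.mem_Icc] at ha ⊢
      simp only [delta, if_true] at hxc ⊢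
      split_ifs at hxc ⊢ <;> omega
    have := Finset.card_le_card hsub
    rw [Nat.card_Icc] at this
    omega

/-- Lemma `lem:cont` part (1): if `λ ∈ W^odd` is reached from the identity
coset by a chain of degree `d ≤ (1^m)` and `max{λ₁,…,λ_m} ≤ 2n+2-m` (i.e. `Λᵐₘ ≤ (m+1)̄`),
then `λ ⪯ δ¹ = ((m+1)̄ | 2 | 3 | ⋯ | m)`. -/
theorem below_delta_one (n m : ℕ) (hn : 1 ≤ n) (hm : 1 ≤ m) (hmn : m ≤ n)
    (lam : ℕ → ℕ) (hlam : Wodd n m lam)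
    (L : List OddRoot) (hchain : IsChainTo n m L lam)
    (hdeg : ∀ k ∈ Finset.Icc 1 m, chainDeg L k ≤ 1)
    (hmax : ∀ i ∈ Finset.Icc 1 m, lam i ≤ 2*n+2-m) :
    Dominates m lam (delta n m 1) := by
  intro k hk i hi
  rw [Finset.mem_Icc] at hk hi
  obtain ⟨hv, hw⟩ := hchain
  obtain ⟨-, hinj, -⟩ := hlam
  have hinj' : ∀ S : Finset ℕ, S ⊆ Finset.Icc 1 m → Set.InjOn lam S := by
    intro S hS a ha b hb hab
    by_contra hne
    exact hinj a (hS ha) b (hS hb) hne hab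
  rcases Nat.lt_or_ge i k with hik | hik
  · refine le_trans (b := i + 1) ?_
      (aux_delta n m hmn k i (i+1) hk.2 hi.1 hi.2 (by omega) (fun _ => le_rfl))
    apply aux_upper _ _ _ hi.1
    have h1 := aux_chain n m hmn (i+1) (by omega) L hv
    have h2 := hdeg (i+1) (Finset.mem_Icc.2 ⟨by omega, by omega⟩)
    set w := (L.map (OddRoot.refl n)).prod with hwdef
    have h3 := Finset.card_filter_add_card_filter_not (s := Finset.Icc 1 (i+1))
      (fun b => w b ∈ Finset.Icc 1 (i+1))
    rw [Nat.card_Icc] at h3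
    have hsub : ((Finset.Icc 1 (i+1)).filter (fun b => w b ∈ Finset.Icc 1 (i+1))).image lam ⊆
        ((Finset.Icc 1 k).image lam).filter (fun x => x ≤ i + 1) := by
      intro x hx
      obtain ⟨a, ha, rfl⟩ := Finset.mem_image.1 hx
      rw [Finset.mem_filter, Finset.mem_Icc] at ha
      have hwa := hw a (Finset.mem_Icc.2 ⟨by omega, by omega⟩)
      refine Finset.mem_filter.2 ⟨Finset.mem_image.2 ⟨a, Finset.mem_Icc.2 ⟨by omega, by omega⟩, rfl⟩, ?_⟩
      rw [← hwa]
      exact (Finset.mem_Icc.1 ha.2).2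
    have h4 := Finset.card_le_card hsub
    rw [Finset.card_image_of_injOn (hinj' _ (by
      intro a ha
      rw [Finset.mem_filter, Finset.mem_Icc] at ha
      exact Finset.mem_Icc.2 ⟨by omega, by omega⟩))] at h4
    omega
  · refine le_trans (b := 2*n+2-m) ?_
      (aux_delta n m hmn k i (2*n+2-m) hk.2 hi.1 hi.2 le_rfl (fun h => by omega))
    apply aux_upper _ _ _ hi.1
    rw [Finset.filter_true_of_mem, Finset.card_image_of_injOn
      (hinj' _ (Finset.Icc_subset_Icc_right hk.2)), Nat.card_Icc]
    · omega
    · intro x hx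
      obtain ⟨a, ha, rfl⟩ := Finset.mem_image.1 hx
      exact hmax a (Finset.Icc_subset_Icc_right hk.2 ha)
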